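/- For n = 0: with A₀, B₀ defined as above (n = 0 case) and under J_0(3ω) ≠ 0 and ωκ²J_0'(κω) ≠ 0, the function Φ₀(r) = (A₀/B₀)J_0(κωr) + H_0^{(1)}(κωr) satisfies rκΦ₀'(r)|_{r=R} = O(1/ln(ωρ/2)) as R → 1⁺ (ρ = 2(R−1) → 0⁺); in particular the Neumann data tends to 0. -/

import Mathlib

open Real Filter

/-- The Bessel function of the first kind of (real) order `ν`, defined by its power series
`J_ν(x) = Σ_{m≥0} (-1)^m / (m! Γ(m+ν+1)) (x/2)^{2m+ν}`. -/
noncomputable def besselJ (ν : ℝ) (x : ℝ) : ℝ :=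
  ∑' m : ℕ, ((-1 : ℝ) ^ m / (m.factorial * Real.Gamma (m + ν + 1))) *
    (x / 2) ^ (2 * (m : ℝ) + ν)

/-- The Bessel function of the second kind of integer order `n`, defined by the limit
`Y_n(x) = lim_{ν → n} (J_ν(x) cos(νπ) - J_{-ν}(x)) / sin(νπ)`. -/
noncomputable def besselY (n : ℕ) (x : ℝ) : ℝ :=
  limUnder (nhdsWithin (n : ℝ) {(n : ℝ)}ᶜ)
    (fun ν => (besselJ ν x * Real.cos (ν * π) - besselJ (-ν) x) / Real.sin (ν * π))

/-- The Hankel function of the first kind of integer order `n`, `H_n^{(1)} = J_n + i Y_n`. -/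
noncomputable def besselH (n : ℕ) (x : ℝ) : ℂ :=
  (besselJ n x : ℂ) + Complex.I * (besselY n x : ℂ)

open Asymptotics Topology

/-- A series `∑ c_m (z/2)^{2m}` with `|c_m| ≤ C 2^m / m!` is entire. -/
lemma differentiable_tsum_even_powers {c : ℕ → ℂ} {C : ℝ}
    (hc : ∀ m, ‖c m‖ ≤ C * 2 ^ m / m.factorial) :
    Differentiable ℂ (fun z : ℂ => ∑' m, c m * (z / 2) ^ (2 * m)) := by
  intro z
  set r : ℝ := ‖z‖ + 1 with hr
  have hC : 0 ≤ C := by simpa using (norm_nonneg _).trans (hc 0)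
  have hsum : Summable fun m : ℕ => C * ((2 * (r / 2) ^ 2) ^ m / m.factorial) :=
    (Real.summable_pow_div_factorial _).mul_left C
  have hd := Complex.differentiableOn_tsum_of_summable_norm (U := Metric.ball (0 : ℂ) r)
    (F := fun m (z : ℂ) => c m * (z / 2) ^ (2 * m)) hsum
    (fun m => by fun_prop) Metric.isOpen_ball (by
      intro m w hw
      have hw' : ‖w‖ ≤ r := (mem_ball_zero_iff.1 hw).le
      rw [norm_mul, norm_pow, norm_div, Complex.norm_ofNat, pow_mul]
      calc ‖c m‖ * ((‖w‖ / 2) ^ 2) ^ m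
          ≤ (C * 2 ^ m / m.factorial) * ((r / 2) ^ 2) ^ m := by
            gcongr
            exact hc m
        _ = C * ((2 * (r / 2) ^ 2) ^ m / m.factorial) := by
            rw [mul_pow]; ring)
  exact hd.differentiableAt (Metric.isOpen_ball.mem_nhds (by simp [hr]))

/-- The real part of an entire function is continuously differentiable along the real axis. -/
lemma contDiff_re_of_differentiable {G : ℂ → ℂ} (hG : Differentiable ℂ G) :
    ContDiff ℝ 1 (fun x : ℝ => (G x).re) :=
  Complex.reCLM.contDiff.comp
    ((hG.contDiff.restrict_scalars ℝ).comp Complex.ofRealCLM.contDiff)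

/-- Geometric bound for `1/Γ(m+1+s)`, uniform for `|s| ≤ 1/2`. -/
lemma exists_norm_inv_Gamma_le :
    ∃ C : ℝ, ∀ (m : ℕ) (s : ℂ), ‖s‖ ≤ 1 / 2 → ‖(Complex.Gamma (m + s + 1))⁻¹‖ ≤ C * 2 ^ m := by
  have hcont : Continuous fun s : ℂ => (Complex.Gamma (s + 1))⁻¹ :=
    Complex.differentiable_one_div_Gamma.continuous.comp (by fun_prop)
  obtain ⟨C, hC⟩ := (isCompact_closedBall (0 : ℂ) (1 / 2)).exists_bound_of_continuousOn
    hcont.continuousOn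
  refine ⟨C, fun m s hs => ?_⟩
  induction m with
  | zero => simpa using hC s (by simpa using hs)
  | succ m ih =>
    have hlow : (1 / 2 : ℝ) ≤ ‖(m : ℂ) + s + 1‖ := by
      have h1 : ‖((m + 1 : ℕ) : ℂ)‖ - ‖-s‖ ≤ ‖((m + 1 : ℕ) : ℂ) - -s‖ := norm_sub_norm_le _ _
      rw [Complex.norm_natCast, norm_neg] at h1
      have h2 : ((m + 1 : ℕ) : ℂ) - -s = (m : ℂ) + s + 1 := by push_cast; ring
      rw [h2] at h1
      have h3 : (1 : ℝ) ≤ ((m + 1 : ℕ) : ℝ) := by simp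
      linarith
    have hne : (m : ℂ) + s + 1 ≠ 0 := by
      rw [← norm_pos_iff]; linarith
    have hrec : Complex.Gamma ((m + 1 : ℕ) + s + 1)
        = ((m : ℂ) + s + 1) * Complex.Gamma (m + s + 1) := by
      rw [← Complex.Gamma_add_one _ hne]; congr 1; push_cast; ring
    rw [hrec, mul_inv, norm_mul, norm_inv]
    have hinv : ‖(m : ℂ) + s + 1‖⁻¹ ≤ 2 := by
      rw [inv_le_comm₀ (by linarith) (by norm_num)]; linarith
    calc ‖(m : ℂ) + s + 1‖⁻¹ * ‖(Complex.Gamma (m + s + 1))⁻¹‖ ≤ 2 * (C * 2 ^ m) := by gcongr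
      _ = C * 2 ^ (m + 1) := by ring

lemma differentiable_inv_Gamma_add (m : ℕ) :
    Differentiable ℂ fun s : ℂ => (Complex.Gamma (m + s + 1))⁻¹ :=
  Complex.differentiable_one_div_Gamma.comp
    (g := fun s : ℂ => (Complex.Gamma s)⁻¹) (f := fun s : ℂ => (m : ℂ) + s + 1) (by fun_prop)

/-- `J_0` is continuously differentiable. -/
lemma contDiff_besselJ_zero : ContDiff ℝ 1 (besselJ 0) := by
  have hd : Differentiable ℂ fun z : ℂ =>
      ∑' m : ℕ, (((-1) ^ m / (m.factorial * m.factorial) : ℝ) : ℂ) * (z / 2) ^ (2 * m) := by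
    refine differentiable_tsum_even_powers (C := 1) fun m => ?_
    rw [Complex.norm_real, norm_div, norm_pow, norm_neg, norm_one, one_pow, norm_mul,
      Real.norm_natCast, one_mul]
    have h1 : (1 : ℝ) ≤ m.factorial := by exact_mod_cast m.factorial_pos
    have h2 : (1 : ℝ) ≤ 2 ^ m := one_le_pow₀ (by norm_num)
    gcongr
    nlinarith
  convert contDiff_re_of_differentiable hd using 1
  ext x
  rw [← Complex.ofReal_re (besselJ 0 x)]
  congr 1
  rw [besselJ, Complex.ofReal_tsum]
  refine tsum_congr fun m => ?_
  have h : (2 * (m : ℝ) + 0) = ((2 * m : ℕ) : ℝ) := by push_cast; ring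
  rw [h, Real.rpow_natCast, add_zero, Real.Gamma_nat_eq_factorial]
  push_cast
  ring

lemma besselJ_zero_zero : besselJ 0 0 = 1 := by
  rw [besselJ, tsum_eq_single 0]
  · simp
  · intro m hm
    have : (2 * (m : ℝ) + 0) ≠ 0 := by simpa using hm
    rw [zero_div, Real.zero_rpow this, mul_zero]

/-- Derivative of `ν ↦ J_ν(x)` at `ν = 0`, with a remainder that is smooth in `x`. -/
lemma exists_hasDerivAt_besselJ_order :
    ∃ g : ℝ → ℝ, ContDiff ℝ 1 g ∧ ∀ x, 0 < x →
      HasDerivAt (fun ν => besselJ ν x) (Real.log (x / 2) * besselJ 0 x + g x) 0 := by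
  obtain ⟨C, hC⟩ := exists_norm_inv_Gamma_le
  set d : ℕ → ℂ := fun m => deriv (fun s : ℂ => (Complex.Gamma (m + s + 1))⁻¹) 0 with hd
  have hdbound : ∀ m, ‖d m‖ ≤ 2 * C * 2 ^ m := by
    intro m
    have := Complex.norm_deriv_le_of_forall_mem_sphere_norm_le (c := (0 : ℂ)) (R := 1 / 2)
      (C := C * 2 ^ m) (f := fun s : ℂ => (Complex.Gamma (m + s + 1))⁻¹) (by norm_num)
      (differentiable_inv_Gamma_add m).diffContOnCl
      (fun z hz => hC m z (by simpa using (mem_sphere_zero_iff_norm.1 hz).le))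
    refine this.trans (le_of_eq ?_)
    ring
  set G : ℂ → ℂ := fun z => ∑' m : ℕ, ((-1) ^ m / m.factorial * d m) * (z / 2) ^ (2 * m)
  have hGd : Differentiable ℂ G := by
    refine differentiable_tsum_even_powers (C := 2 * C) fun m => ?_
    rw [norm_mul, norm_div, norm_pow, norm_neg, norm_one, one_pow, Complex.norm_natCast,
      mul_comm, mul_one_div]
    gcongr
    exact hdbound m
  refine ⟨_, contDiff_re_of_differentiable hGd, fun x hx => ?_⟩
  set a : ℕ → ℂ → ℂ := fun m s =>
    ((-1) ^ m / m.factorial * (Complex.Gamma (m + s + 1))⁻¹) * ((x : ℂ) / 2) ^ (2 * m) with ha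
  set U : Set ℂ := Metric.ball 0 (1 / 2)
  have h0U : (0 : ℂ) ∈ U := by simp [U]
  have hsum : Summable fun m : ℕ => C * ((2 * (x / 2) ^ 2) ^ m / m.factorial) :=
    (Real.summable_pow_div_factorial _).mul_left C
  have had : ∀ m, DifferentiableOn ℂ (a m) U := fun m =>
    (((differentiable_inv_Gamma_add m).const_mul _).mul_const _).differentiableOn
  have hab : ∀ m, ∀ s ∈ U, ‖a m s‖ ≤ C * ((2 * (x / 2) ^ 2) ^ m / m.factorial) := by
    intro m s hs
    have hx' : ‖(x : ℂ) / 2‖ = x / 2 := by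
      rw [norm_div, Complex.norm_ofNat, Complex.norm_real, Real.norm_of_nonneg hx.le]
    simp only [ha]
    rw [norm_mul, norm_mul, norm_div, norm_pow, norm_neg, norm_one, one_pow,
      Complex.norm_natCast, norm_pow, hx', pow_mul]
    calc 1 / (m.factorial : ℝ) * ‖(Complex.Gamma (m + s + 1))⁻¹‖ * ((x / 2) ^ 2) ^ m
        ≤ 1 / (m.factorial : ℝ) * (C * 2 ^ m) * ((x / 2) ^ 2) ^ m := by
          gcongr
          exact hC m s (mem_ball_zero_iff.1 hs).le
      _ = C * ((2 * (x / 2) ^ 2) ^ m / m.factorial) := by rw [mul_pow]; ring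
  have hF := (Complex.differentiableOn_tsum_of_summable_norm hsum had Metric.isOpen_ball
    hab).differentiableAt (Metric.isOpen_ball.mem_nhds h0U)
  have hFd := Complex.hasSum_deriv_of_summable_norm hsum had Metric.isOpen_ball hab h0U
  have hFG : deriv (fun s => ∑' m, a m s) 0 = G x := by
    rw [← hFd.tsum_eq]
    refine tsum_congr fun m => ?_
    simp only [ha, hd]
    rw [deriv_mul_const_field, deriv_const_mul_field]
  have hFr : HasDerivAt (fun ν : ℝ => (∑' m, a m ν).re) (G x).re 0 := by
    have := hF.hasDerivAt
    rw [hFG] at this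
    exact HasDerivAt.real_of_complex (z := 0) (by simpa using this)
  have hfac : ∀ ν : ℝ, besselJ ν x = (x / 2) ^ ν * (∑' m, a m ν).re := by
    intro ν
    have hx2 : 0 < x / 2 := by positivity
    have hre : (∑' m, a m ν).re
        = ∑' m : ℕ, (-1) ^ m / (m.factorial * Real.Gamma (m + ν + 1)) * (x / 2) ^ (2 * m) := by
      rw [← Complex.ofReal_re (∑' m : ℕ, _), Complex.ofReal_tsum]
      congr 1
      refine tsum_congr fun m => ?_
      simp only [ha]
      push_cast
      rw [← Complex.Gamma_ofReal]
      push_cast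
      rw [div_mul_eq_div_div, div_eq_mul_inv _ (Complex.Gamma _)]
    rw [hre, ← tsum_mul_left, besselJ]
    refine tsum_congr fun m => ?_
    have h : (2 * (m : ℝ)) = ((2 * m : ℕ) : ℝ) := by push_cast; ring
    rw [Real.rpow_add hx2, h, Real.rpow_natCast]
    ring
  have hJ0 : (∑' m, a m (0 : ℝ)).re = besselJ 0 x := by simp [hfac 0]
  have hpow : HasDerivAt (fun ν : ℝ => (x / 2) ^ ν) (Real.log (x / 2)) 0 := by
    simpa using (hasDerivAt_id (0 : ℝ)).const_rpow (a := x / 2) (by positivity)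
  have := hpow.mul hFr
  rw [hJ0] at this
  simp only [Real.rpow_zero, one_mul] at this
  exact this.congr_of_eventuallyEq (Eventually.of_forall hfac)

/-- If `F` is differentiable at `0`, the quotient defining `Y_0` tends to `2 F'(0) / π`. -/
lemma tendsto_bessel_quotient {F : ℝ → ℝ} {F' : ℝ} (hF : HasDerivAt F F' 0) :
    Tendsto (fun ν => (F ν * Real.cos (ν * π) - F (-ν)) / Real.sin (ν * π)) (𝓝[≠] 0)
      (𝓝 (2 / π * F')) := by
  have hlin : HasDerivAt (fun ν : ℝ => ν * π) π 0 := by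
    simpa using (hasDerivAt_id (0 : ℝ)).mul_const π
  have hcos := hlin.cos
  have hsin := hlin.sin
  have hneg : HasDerivAt (fun ν => F (-ν)) (-F') 0 := by
    have h : HasDerivAt F F' (-0) := by simpa using hF
    simpa [Function.comp_def] using HasDerivAt.comp (0 : ℝ) h (hasDerivAt_neg (0 : ℝ))
  have hN := (hF.mul hcos).sub hneg
  have h1 := hasDerivAt_iff_tendsto_slope.1 hN
  have h2 := hasDerivAt_iff_tendsto_slope.1 hsin
  have h3 := h1.div h2 (by simp [pi_ne_zero])
  have hlim : (F' * Real.cos (0 * π) + F 0 * (-Real.sin (0 * π) * π) - -F')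
      / (Real.cos (0 * π) * π) = 2 / π * F' := by
    simp; ring
  rw [hlim] at h3
  refine h3.congr' ?_
  filter_upwards [self_mem_nhdsWithin] with ν hν
  have hν : ν ≠ 0 := hν
  simp only [Pi.div_apply, slope_def_field, Pi.sub_apply, Pi.mul_apply]
  simp only [zero_mul, Real.cos_zero, Real.sin_zero, mul_one, neg_zero, sub_self, sub_zero]
  field_simp

/-- Logarithmic representation of `H_0^{(1)}` on the positive axis. -/
lemma exists_besselH_zero_eq :
    ∃ g : ℝ → ℝ, ContDiff ℝ 1 g ∧ ∀ x, 0 < x →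
      besselH 0 x = (besselJ 0 x : ℂ) +
        Complex.I * ((2 / π * (Real.log (x / 2) * besselJ 0 x + g x) : ℝ) : ℂ) := by
  obtain ⟨g, hg, hder⟩ := exists_hasDerivAt_besselJ_order
  refine ⟨g, hg, fun x hx => ?_⟩
  have hY : besselY 0 x = 2 / π * (Real.log (x / 2) * besselJ 0 x + g x) := by
    rw [besselY, Nat.cast_zero]
    exact (tendsto_bessel_quotient (hder x hx)).limUnder_eq
  rw [besselH, hY, Nat.cast_zero]

/-- For `b = q J - p J'`, the combination `((p H' - q H) / b) J' + H'` is a multiple of the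
Wronskian `J H' - H J'`. -/
lemma wronskian_cancel {p q J J' H H' b : ℂ} (hb : b = q * J - p * J') (hb0 : b ≠ 0) :
    (p * H' - q * H) / b * J' + H' = q * (J * H' - H * J') / b := by
  field_simp
  rw [hb]
  ring

lemma hasDerivAt_besselJ_zero (x : ℝ) :
    HasDerivAt (besselJ 0) (deriv (besselJ 0) x) x :=
  (contDiff_besselJ_zero.differentiable one_ne_zero x).hasDerivAt

lemma hasDerivAt_ofReal_besselJ_zero (x : ℝ) :
    HasDerivAt (fun t => (besselJ 0 t : ℂ)) ((deriv (besselJ 0) x : ℝ) : ℂ) x :=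
  (hasDerivAt_besselJ_zero x).ofReal_comp

lemma continuous_deriv_besselJ_zero : Continuous (deriv (besselJ 0)) :=
  contDiff_besselJ_zero.continuous_deriv le_rfl

/-- Derivative of `H_0^{(1)}` on the positive axis, with a continuous remainder `g'`. -/
lemma exists_hasDerivAt_besselH_zero :
    ∃ g' : ℝ → ℝ, Continuous g' ∧ ∀ x, 0 < x →
      HasDerivAt (besselH 0) (((deriv (besselJ 0) x : ℝ) : ℂ) + Complex.I *
        ((2 / π * (besselJ 0 x / x + Real.log (x / 2) * deriv (besselJ 0) x + g' x) : ℝ) : ℂ))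
        x := by
  obtain ⟨g, hg, hH⟩ := exists_besselH_zero_eq
  refine ⟨deriv g, hg.continuous_deriv le_rfl, fun x hx => ?_⟩
  have hlog : HasDerivAt (fun t : ℝ => Real.log (t / 2)) x⁻¹ x := by
    have h := ((hasDerivAt_id x).div_const 2).log (by simpa using hx.ne')
    refine h.congr_deriv ?_
    simp only [id]
    field_simp
  have hY := ((hlog.mul (hasDerivAt_besselJ_zero x)).add
    (hg.differentiable one_ne_zero x).hasDerivAt).const_mul (2 / π)
  have h := (hasDerivAt_ofReal_besselJ_zero x).add (hY.ofReal_comp.const_mul Complex.I)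
  refine (h.congr_of_eventuallyEq ?_).congr_deriv ?_
  · filter_upwards [lt_mem_nhds hx] with t ht
    exact hH t ht
  · rw [inv_mul_eq_div]

lemma differentiableAt_besselH_zero {x : ℝ} (hx : 0 < x) :
    DifferentiableAt ℝ (besselH 0) x := by
  obtain ⟨g', -, h⟩ := exists_hasDerivAt_besselH_zero
  exact (h x hx).differentiableAt

lemma continuousAt_deriv_besselH_zero {x : ℝ} (hx : 0 < x) :
    ContinuousAt (deriv (besselH 0)) x := by
  obtain ⟨g', hg', h⟩ := exists_hasDerivAt_besselH_zero
  have hJ := contDiff_besselJ_zero.continuous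
  have hJ' := continuous_deriv_besselJ_zero
  have hlog : ContinuousAt (fun t : ℝ => Real.log (t / 2)) x :=
    (continuousAt_id.div_const 2).log (by simpa using hx.ne')
  have hq : ContinuousAt (fun t => besselJ 0 t / t) x :=
    hJ.continuousAt.div continuousAt_id hx.ne'
  have hc : ContinuousAt (fun x : ℝ => ((deriv (besselJ 0) x : ℝ) : ℂ) + Complex.I *
      ((2 / π * (besselJ 0 x / x + Real.log (x / 2) * deriv (besselJ 0) x + g' x) : ℝ) : ℂ))
      x := by
    have hY := ((hq.add (hlog.mul hJ'.continuousAt)).add hg'.continuousAt).const_mul (2 / π)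
    exact (Complex.continuous_ofReal.comp hJ').continuousAt.add
      ((Complex.continuous_ofReal.continuousAt.comp hY).const_mul Complex.I)
  refine hc.congr ?_
  filter_upwards [lt_mem_nhds hx] with t ht
  exact (h t ht).deriv.symm

lemma tendsto_log_half_nhdsGT_zero :
    Tendsto (fun x : ℝ => Real.log (x / 2)) (𝓝[>] 0) atBot := by
  refine Real.tendsto_log_nhdsGT_zero.comp (tendsto_nhdsWithin_iff.2 ⟨?_, ?_⟩)
  · have : Tendsto (fun x : ℝ => x / 2) (𝓝 0) (𝓝 (0 / 2)) := tendsto_id.div_const 2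
    rw [zero_div] at this
    exact this.mono_left nhdsWithin_le_nhds
  · filter_upwards [self_mem_nhdsWithin] with x hx
    have hx : 0 < x := hx
    exact Set.mem_Ioi.2 (by positivity)

lemma tendsto_besselJ_zero_nhdsGT_zero : Tendsto (besselJ 0) (𝓝[>] 0) (𝓝 1) := by
  have h := contDiff_besselJ_zero.continuous.tendsto 0
  rw [besselJ_zero_zero] at h
  exact h.mono_left nhdsWithin_le_nhds

/-- `H_0^{(1)}(x) ~ (2i/π) ln(x/2)` as `x → 0⁺`. -/
lemma tendsto_besselH_zero_div_log :
    Tendsto (fun x : ℝ => besselH 0 x / (Real.log (x / 2) : ℂ)) (𝓝[>] 0)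
      (𝓝 (Complex.I * ((2 / π : ℝ) : ℂ))) := by
  obtain ⟨g, hg, hH⟩ := exists_besselH_zero_eq
  have hinv := tendsto_inv_atBot_zero.comp tendsto_log_half_nhdsGT_zero
  have hJ := tendsto_besselJ_zero_nhdsGT_zero
  have hg0 : Tendsto g (𝓝[>] 0) (𝓝 (g 0)) :=
    (hg.continuous.tendsto 0).mono_left nhdsWithin_le_nhds
  have hre := hJ.mul hinv
  have him := (hJ.add (hg0.mul hinv)).const_mul (2 / π)
  have h := hre.ofReal.add (him.ofReal.const_mul Complex.I)
  simp only [mul_zero, add_zero, mul_one, Complex.ofReal_zero, zero_add] at h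
  refine h.congr' ?_
  filter_upwards [self_mem_nhdsWithin, tendsto_log_half_nhdsGT_zero.eventually_lt_atBot 0]
    with x hx hL
  have hL' : (Real.log (x / 2) : ℂ) ≠ 0 := Complex.ofReal_ne_zero.2 hL.ne
  rw [hH x hx]
  simp only [Function.comp_apply]
  push_cast
  field_simp

/-- `(H_0^{(1)})'(x) ~ 2i/(πx)` as `x → 0⁺`. -/
lemma tendsto_mul_deriv_besselH_zero :
    Tendsto (fun x : ℝ => (x : ℂ) * deriv (besselH 0) x) (𝓝[>] 0)
      (𝓝 (Complex.I * ((2 / π : ℝ) : ℂ))) := by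
  obtain ⟨g', hg', hH⟩ := exists_hasDerivAt_besselH_zero
  have hid : Tendsto (fun x : ℝ => x) (𝓝[>] 0) (𝓝 0) := nhdsWithin_le_nhds
  have hJ := tendsto_besselJ_zero_nhdsGT_zero
  have hJ' : Tendsto (deriv (besselJ 0)) (𝓝[>] 0) (𝓝 (deriv (besselJ 0) 0)) :=
    (continuous_deriv_besselJ_zero.tendsto 0).mono_left nhdsWithin_le_nhds
  have hg0 : Tendsto g' (𝓝[>] 0) (𝓝 (g' 0)) :=
    (hg'.tendsto 0).mono_left nhdsWithin_le_nhds
  have hxlog : Tendsto (fun x : ℝ => x * Real.log (x / 2)) (𝓝[>] 0) (𝓝 0) := by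
    have hc : Continuous fun x : ℝ => x / 2 * Real.log (x / 2) * 2 :=
      (Real.continuous_mul_log.comp (continuous_id.div_const 2)).mul_const 2
    have h := (hc.tendsto 0).mono_left (nhdsWithin_le_nhds (s := Set.Ioi 0))
    simp only [zero_div, zero_mul] at h
    exact h.congr fun x => by ring
  have him := ((hJ.add (hxlog.mul hJ')).add (hid.mul hg0)).const_mul (2 / π)
  have h := (hid.mul hJ').ofReal.add (him.ofReal.const_mul Complex.I)
  simp only [zero_mul, add_zero, mul_one, Complex.ofReal_zero, zero_add] at h
  refine h.congr' ?_
  filter_upwards [self_mem_nhdsWithin] with x hx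
  have hx' : (x : ℂ) ≠ 0 := Complex.ofReal_ne_zero.2 (ne_of_gt hx)
  rw [(hH x hx).deriv]
  push_cast
  field_simp

open Filter Asymptotics in
/-- the case `n = 0`. With `A₀, B₀` defined as before (order `0`), and under
`J_0(3ω) ≠ 0` and `ωκ² J_0'(κω) ≠ 0`, the function
`Φ₀(r) = (A₀/B₀) J_0(κωr) + H_0^{(1)}(κωr)` satisfies
`rκ Φ₀'(r)|_{r=R} = O(1/ln(ωρ/2))` with `ρ = 2(R-1)` as `R → 1⁺`; in particular the
Neumann data tends to `0`. -/
theorem stmt16 (κ ω : ℝ) (hκ : 0 < κ) (hω : 0 < ω)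
    (hJ3 : besselJ 0 (3 * ω) ≠ 0)
    (hnonres : ω * κ ^ 2 * deriv (besselJ 0) (κ * ω) ≠ 0)
    (l₁ l₂ : ℝ → ℂ)
    (hl₁ : l₁ = fun ρ => (besselJ 0 (ω * ρ) : ℂ) * besselH 0 (3 * ω) -
      besselH 0 (ω * ρ) * (besselJ 0 (3 * ω) : ℂ))
    (hl₂ : l₂ = fun ρ => (deriv (fun t => (besselJ 0 t : ℂ)) (ω * ρ)) * besselH 0 (3 * ω) -
      (deriv (besselH 0) (ω * ρ)) * (besselJ 0 (3 * ω) : ℂ))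
    (A B : ℝ → ℂ)
    (hA : A = fun R => (κ : ℂ) ^ 2 * R * deriv (besselH 0) (κ * ω * R) * l₁ (2 * (R - 1)) -
      (2 * (R - 1) : ℝ) * besselH 0 (κ * ω * R) * l₂ (2 * (R - 1)))
    (hB : B = fun R => (2 * (R - 1) : ℝ) * (besselJ 0 (κ * ω * R) : ℂ) * l₂ (2 * (R - 1)) -
      (κ : ℂ) ^ 2 * R * deriv (fun t => (besselJ 0 t : ℂ)) (κ * ω * R) * l₁ (2 * (R - 1)))
    (Φ : ℝ → ℝ → ℂ)
    (hΦ : Φ = fun R r => (A R / B R) * (besselJ 0 (κ * ω * r) : ℂ) + besselH 0 (κ * ω * r)) :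
    ((fun R : ℝ => (R : ℂ) * κ * deriv (Φ R) R)
        =O[nhdsWithin 1 (Set.Ioi 1)]
      (fun R : ℝ => (Real.log (ω * (2 * (R - 1)) / 2))⁻¹)) ∧
    Tendsto (fun R : ℝ => (R : ℂ) * κ * deriv (Φ R) R)
      (nhdsWithin 1 (Set.Ioi 1)) (nhds 0) := by
  have hpi : ((2 / π : ℝ) : ℂ) ≠ 0 := Complex.ofReal_ne_zero.2 (by positivity)
  have hJ3' : (besselJ 0 (3 * ω) : ℂ) ≠ 0 := Complex.ofReal_ne_zero.2 hJ3
  have hJ' : ((deriv (besselJ 0) (κ * ω) : ℝ) : ℂ) ≠ 0 :=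
    Complex.ofReal_ne_zero.2 (right_ne_zero_of_mul hnonres)
  have hκ' : (κ : ℂ) ≠ 0 := Complex.ofReal_ne_zero.2 hκ.ne'
  have hω' : (ω : ℂ) ≠ 0 := Complex.ofReal_ne_zero.2 hω.ne'
  have hderivJ : ∀ x : ℝ, deriv (fun t => (besselJ 0 t : ℂ)) x = ((deriv (besselJ 0) x : ℝ) : ℂ) :=
    fun x => (hasDerivAt_ofReal_besselJ_zero x).deriv
  have hpos : 0 < κ * ω := by positivity
  set F := nhdsWithin (1 : ℝ) (Set.Ioi 1)
  set L : ℝ → ℝ := fun R => Real.log (ω * (2 * (R - 1)) / 2) with hL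
  have hR : Tendsto (fun R : ℝ => R) F (𝓝 1) := nhdsWithin_le_nhds
  have hx : Tendsto (fun R : ℝ => κ * ω * R) F (𝓝 (κ * ω)) := by
    simpa using hR.const_mul (κ * ω)
  have ht : Tendsto (fun R : ℝ => ω * (2 * (R - 1))) F (𝓝[>] 0) := by
    refine tendsto_nhdsWithin_iff.2 ⟨?_, ?_⟩
    · simpa using ((hR.sub_const 1).const_mul 2).const_mul ω
    · filter_upwards [self_mem_nhdsWithin] with R hR1
      have hR1 : 0 < R - 1 := sub_pos.2 hR1
      exact Set.mem_Ioi.2 (by positivity)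
  have ht0 : Tendsto (fun R : ℝ => ω * (2 * (R - 1))) F (𝓝 0) :=
    ht.mono_right nhdsWithin_le_nhds
  have hLbot : Tendsto L F atBot := tendsto_log_half_nhdsGT_zero.comp ht
  have hLinv : Tendsto (fun R => (L R)⁻¹) F (𝓝 0) := tendsto_inv_atBot_zero.comp hLbot
  have hLinvC : Tendsto (fun R => ((L R : ℂ))⁻¹) F (𝓝 0) := by
    simpa using hLinv.ofReal
  have hLne : ∀ᶠ R in F, (L R : ℂ) ≠ 0 := by
    filter_upwards [hLbot.eventually_lt_atBot 0] with R h
    exact Complex.ofReal_ne_zero.2 h.ne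
  have hl₁lim : Tendsto (fun R => l₁ (2 * (R - 1)) / (L R : ℂ)) F
      (𝓝 (-(Complex.I * ((2 / π : ℝ) : ℂ) * besselJ 0 (3 * ω)))) := by
    have h1 := ((tendsto_besselJ_zero_nhdsGT_zero.comp ht).ofReal.mul hLinvC).mul_const
      (besselH 0 (3 * ω))
    have h2 := (tendsto_besselH_zero_div_log.comp ht).mul_const (besselJ 0 (3 * ω) : ℂ)
    have h := h1.sub h2
    simp only [mul_zero, zero_mul, zero_sub] at h
    refine h.congr fun R => ?_
    simp only [hl₁, hL, Function.comp_apply]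
    ring
  have hl₂lim : Tendsto (fun R : ℝ => ((2 * (R - 1) : ℝ) : ℂ) * l₂ (2 * (R - 1))) F
      (𝓝 ((ω : ℂ)⁻¹ * -(Complex.I * ((2 / π : ℝ) : ℂ) * besselJ 0 (3 * ω)))) := by
    have h1 := ((ht0.mul ((continuous_deriv_besselJ_zero.tendsto 0).comp ht0)).ofReal).mul_const
      (besselH 0 (3 * ω))
    have h2 := (tendsto_mul_deriv_besselH_zero.comp ht).mul_const (besselJ 0 (3 * ω) : ℂ)
    have h := (h1.sub h2).const_mul (ω : ℂ)⁻¹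
    simp only [zero_mul, Complex.ofReal_zero, zero_sub] at h
    refine h.congr fun R => ?_
    simp only [hl₂, hderivJ, Function.comp_apply]
    push_cast
    field_simp
  have hJlim : Tendsto (fun R : ℝ => (besselJ 0 (κ * ω * R) : ℂ)) F
      (𝓝 (besselJ 0 (κ * ω) : ℂ)) :=
    ((contDiff_besselJ_zero.continuous.tendsto _).comp hx).ofReal
  have hJ'lim : Tendsto (fun R : ℝ => ((deriv (besselJ 0) (κ * ω * R) : ℝ) : ℂ)) F
      (𝓝 ((deriv (besselJ 0) (κ * ω) : ℝ) : ℂ)) :=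
    ((continuous_deriv_besselJ_zero.tendsto _).comp hx).ofReal
  have hHlim : Tendsto (fun R : ℝ => besselH 0 (κ * ω * R)) F (𝓝 (besselH 0 (κ * ω))) :=
    (differentiableAt_besselH_zero hpos).continuousAt.tendsto.comp hx
  have hH'lim : Tendsto (fun R : ℝ => deriv (besselH 0) (κ * ω * R)) F
      (𝓝 (deriv (besselH 0) (κ * ω))) :=
    (continuousAt_deriv_besselH_zero hpos).tendsto.comp hx
  have hRC : Tendsto (fun R : ℝ => (R : ℂ)) F (𝓝 1) := by simpa using hR.ofReal
  obtain ⟨b, hb0, hBlim⟩ : ∃ b : ℂ, b ≠ 0 ∧ Tendsto (fun R => B R / (L R : ℂ)) F (𝓝 b) := by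
    have h1 := (hJlim.mul hl₂lim).mul hLinvC
    have h2 := ((hRC.const_mul ((κ : ℂ) ^ 2)).mul hJ'lim).mul hl₁lim
    refine ⟨_, ?_, (h1.sub h2).congr fun R => ?_⟩
    · simp only [mul_zero, zero_sub, mul_one, mul_neg, neg_neg]
      have hI := Complex.I_ne_zero
      positivity
    · simp only [hB, hderivJ]
      ring
  have hBne : ∀ᶠ R in F, B R ≠ 0 := by
    filter_upwards [hBlim.eventually_ne hb0] with R h h0
    exact h (by rw [h0, zero_div])
  have hΦ' : ∀ᶠ R in F, deriv (Φ R) R = (κ * ω : ℂ) * (((2 * (R - 1) : ℝ) : ℂ) *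
      l₂ (2 * (R - 1)) * ((besselJ 0 (κ * ω * R) : ℂ) * deriv (besselH 0) (κ * ω * R) -
        besselH 0 (κ * ω * R) * ((deriv (besselJ 0) (κ * ω * R) : ℝ) : ℂ)) / B R) := by
    filter_upwards [hBne, self_mem_nhdsWithin] with R hBR hR1
    have hR0 : 0 < R := zero_lt_one.trans hR1
    have hxpos : 0 < κ * ω * R := by positivity
    have hlin : HasDerivAt (fun r : ℝ => κ * ω * r) (κ * ω) R := by
      simpa using (hasDerivAt_id R).const_mul (κ * ω)
    have hJd := (hasDerivAt_ofReal_besselJ_zero (κ * ω * R)).scomp R hlin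
    have hHd := (differentiableAt_besselH_zero hxpos).hasDerivAt.scomp R hlin
    have hd := (hJd.const_mul (A R / B R)).add hHd
    have hW := wronskian_cancel (p := (κ : ℂ) ^ 2 * R * l₁ (2 * (R - 1)))
      (q := ((2 * (R - 1) : ℝ) : ℂ) * l₂ (2 * (R - 1))) (J := (besselJ 0 (κ * ω * R) : ℂ))
      (J' := ((deriv (besselJ 0) (κ * ω * R) : ℝ) : ℂ)) (H := besselH 0 (κ * ω * R))
      (H' := deriv (besselH 0) (κ * ω * R)) (b := B R)
      (by simp only [hB, hderivJ]; ring) hBR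
    have hAR : A R = (κ : ℂ) ^ 2 * R * l₁ (2 * (R - 1)) * deriv (besselH 0) (κ * ω * R) -
        ((2 * (R - 1) : ℝ) : ℂ) * l₂ (2 * (R - 1)) * besselH 0 (κ * ω * R) := by
      simp only [hA]; ring
    have hd' := hd.congr_of_eventuallyEq (f₁ := Φ R)
      (Eventually.of_forall fun r => by simp [hΦ])
    rw [hd'.deriv, ← hW, ← hAR]
    simp only [Complex.real_smul]
    push_cast
    ring
  have hO : (fun R : ℝ => (R : ℂ) * κ * deriv (Φ R) R) =O[F] (fun R : ℝ => (L R)⁻¹) := by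
    have hlim := ((hRC.mul_const (κ : ℂ)).mul ((((hl₂lim.mul ((hJlim.mul hH'lim).sub
      (hHlim.mul hJ'lim)))).div hBlim hb0).const_mul (κ * ω : ℂ))).isBigO_one ℝ
    have hLO : (fun R => ((L R)⁻¹ : ℂ)) =O[F] (fun R : ℝ => (L R)⁻¹) :=
      isBigO_of_le F fun R => by simp
    have hprod := hlim.mul hLO
    refine hprod.congr' ?_ ?_
    · filter_upwards [hΦ', hLne, hBne] with R h hLR hBR
      rw [h]
      simp only [Pi.div_apply]
      field_simp
    · exact Eventually.of_forall fun R => one_mul _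
  exact ⟨hO, hO.trans_tendsto hLinv⟩
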